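/- arXiv:2406.09697 — 2 statements merged into one kernel-verified Lean document; each statement's English description precedes it below -/
import Mathlib

section
/- Let n ≥ 12 be an integer divisible by 4, and let m be a positive integer divisible by 4 such that m⁴ < (n−1)^(n−8). Then there is no Seidel matrix S of order n with det S = ((n−1)^(n/4) − m)². -/
open Matrix

/-- A Seidel matrix: zero diagonal, off-diagonal entries `±1`, skew-symmetric. -/
def IsSeidel {n : ℕ} (S : Matrix (Fin n) (Fin n) ℤ) : Prop :=
  (∀ i, S i i = 0) ∧ (∀ i j, i ≠ j → S i j = 1 ∨ S i j = -1) ∧ Sᵀ = -S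

/-- Hadamard's determinant inequality for real matrices. -/
theorem Matrix.det_sq_le_prod_dotProduct {n : ℕ} (M : Matrix (Fin n) (Fin n) ℝ) :
    M.det ^ 2 ≤ ∏ i, M i ⬝ᵥ M i := by
  have : Fact (Module.finrank ℝ (EuclideanSpace ℝ (Fin n)) = n) := ⟨by simp⟩
  let b := EuclideanSpace.basisFun (Fin n) ℝ
  let v : Fin n → EuclideanSpace ℝ (Fin n) := fun i => WithLp.toLp 2 (M i)
  have hdet : b.toBasis.orientation.volumeForm v = M.det := by
    rw [b.toBasis.orientation.volumeForm_robust b rfl, Module.Basis.det_apply, ← det_transpose]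
    rfl
  have hnorm (i : Fin n) : ‖v i‖ ^ 2 = M i ⬝ᵥ M i := by
    rw [EuclideanSpace.norm_sq_eq]
    simp [v, dotProduct, sq]
  have h := b.toBasis.orientation.abs_volumeForm_apply_le v
  rw [hdet] at h
  calc M.det ^ 2 = |M.det| ^ 2 := (sq_abs _).symm
    _ ≤ (∏ i, ‖v i‖) ^ 2 := by gcongr
    _ = ∏ i, M i ⬝ᵥ M i := by simp_rw [← Finset.prod_pow, hnorm]

/-- If all rows of `M` have squared norm `N`, two rows with inner product `g` improve Hadamard's
bound by the factor `1 - g² / N²`. -/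
theorem Matrix.det_sq_le_of_dotProduct_self_eq {n : ℕ} (M : Matrix (Fin n) (Fin n) ℝ) {N : ℝ}
    (hN : 0 < N) (hM : ∀ i, M i ⬝ᵥ M i = N) {i j : Fin n} (hij : i ≠ j) :
    M.det ^ 2 ≤ N ^ n * (1 - (M i ⬝ᵥ M j) ^ 2 / N ^ 2) := by
  set g := M i ⬝ᵥ M j with hg
  have hrow : (M j + (-(g / N)) • M i) ⬝ᵥ (M j + (-(g / N)) • M i) = N * (1 - g ^ 2 / N ^ 2) := by
    simp only [add_dotProduct, dotProduct_add, smul_dotProduct, dotProduct_smul, hM,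
      dotProduct_comm (M j) (M i), ← hg, smul_eq_mul]
    field_simp
    ring
  have h := det_sq_le_prod_dotProduct (M.updateRow j (M j + (-(g / N)) • M i))
  rw [det_updateRow_add_smul_self M hij.symm, ← Finset.mul_prod_erase _ _ (Finset.mem_univ j),
    updateRow_self, hrow] at h
  rw [Finset.prod_congr rfl (g := fun _ => N) (fun k hk => by
    rw [updateRow_ne (Finset.ne_of_mem_erase hk), hM])] at h
  refine h.trans_eq ?_
  obtain ⟨k, rfl⟩ : ∃ k, n = k + 1 := ⟨n - 1, by have := i.pos; omega⟩
  simp [pow_succ]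
  ring

namespace IsSeidel

variable {n : ℕ} {S : Matrix (Fin n) (Fin n) ℤ}

theorem dotProduct_self (hS : IsSeidel S) (i : Fin n) : S i ⬝ᵥ S i = (n : ℤ) - 1 := by
  have h (k : Fin n) : S i k * S i k = 1 - if i = k then 1 else 0 := by
    split_ifs with hik
    · subst hik; simp [hS.1]
    · rcases hS.2.1 i k hik with h | h <;> simp [h]
  simp [dotProduct, h]

theorem even_dotProduct (hS : IsSeidel S) (hn : Even n) {i j : Fin n} (hij : i ≠ j) :
    Even (S i ⬝ᵥ S j) := by
  have h (i k : Fin n) : (S i k : ZMod 2) = 1 - if i = k then 1 else 0 := by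
    split_ifs with hik
    · subst hik; simp [hS.1]
    · rcases hS.2.1 i k hik with h | h <;> simp [h]
  have hn2 : (n : ZMod 2) = 0 := (ZMod.natCast_eq_zero_iff_even).2 hn
  rw [← ZMod.intCast_eq_zero_iff_even]
  simp [dotProduct, h, mul_sub, hij, hn2]

/-- The determinant of a Seidel matrix of even order either attains Hadamard's bound or misses it
by a factor of at most `1 - 4 / (n - 1)²`. -/
theorem det_sq_eq_or_le (hS : IsSeidel S) (hn : Even n) (hn2 : 2 ≤ n) :
    S.det ^ 2 = ((n : ℤ) - 1) ^ n ∨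
      (S.det : ℝ) ^ 2 ≤ ((n : ℝ) - 1) ^ n * (1 - 4 / ((n : ℝ) - 1) ^ 2) := by
  have hn2' : (2 : ℝ) ≤ n := by exact_mod_cast hn2
  have hN : (0 : ℝ) < (n : ℝ) - 1 := by linarith
  by_cases hG : ∀ i j, i ≠ j → S i ⬝ᵥ S j = 0
  · left
    have hmul : S * Sᵀ = ((n : ℤ) - 1) • (1 : Matrix (Fin n) (Fin n) ℤ) := by
      ext i j
      change S i ⬝ᵥ S j = _
      by_cases hij : i = j
      · subst hij; simp [hS.dotProduct_self]
      · simp [hG i j hij, hij]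
    have h := congrArg det hmul
    rwa [det_mul, det_transpose, det_smul, det_one, mul_one, Fintype.card_fin, ← sq] at h
  · right
    push Not at hG
    obtain ⟨i, j, hij, hg⟩ := hG
    have hcast (i j : Fin n) :
        S.map (Int.cast : ℤ → ℝ) i ⬝ᵥ S.map (Int.cast : ℤ → ℝ) j = ((S i ⬝ᵥ S j : ℤ) : ℝ) := by
      simp [dotProduct]
    have h := det_sq_le_of_dotProduct_self_eq (S.map (Int.cast : ℤ → ℝ)) hN
      (fun i => by rw [hcast, hS.dotProduct_self]; push_cast; rfl) hij
    rw [hcast, ← Int.cast_det] at h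
    have hg4 : (4 : ℤ) ≤ (S i ⬝ᵥ S j) ^ 2 := by
      obtain ⟨r, hr⟩ := hS.even_dotProduct hn hij
      have hr0 : r ≠ 0 := by rintro rfl; exact hg hr
      have : 0 < r ^ 2 := by positivity
      rw [hr]
      nlinarith
    have hg4' : (4 : ℝ) ≤ ((S i ⬝ᵥ S j : ℤ) : ℝ) ^ 2 := by exact_mod_cast hg4
    refine h.trans ?_
    gcongr

end IsSeidel

/-- gap below the maximum: for `n ≥ 12` divisible by `4` and a
positive `m` divisible by `4` with `m⁴ < (n-1)^(n-8)`, no Seidel matrix of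
order `n` has determinant `((n-1)^(n/4) - m)²`. -/
theorem gap_in_seidel_determinants (n m : ℕ) (hn : 12 ≤ n) (h4n : 4 ∣ n)
    (hm : 0 < m) (h4m : 4 ∣ m) (hmb : (m : ℤ) ^ 4 < ((n : ℤ) - 1) ^ (n - 8)) :
    ¬ ∃ S : Matrix (Fin n) (Fin n) ℤ, IsSeidel S ∧
        S.det = (((n : ℤ) - 1) ^ (n / 4) - (m : ℤ)) ^ 2 := by
  rintro ⟨S, hS, hdet⟩
  obtain ⟨k, hk⟩ : ∃ k, n = 4 * (k + 2) := ⟨n / 4 - 2, by omega⟩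
  have hn' : (12 : ℝ) ≤ n := by exact_mod_cast hn
  have hN : (1 : ℝ) < (n : ℝ) - 1 := by linarith
  rw [show n / 4 = k + 2 by omega] at hdet
  rw [show n - 8 = k * 4 by omega, pow_mul] at hmb
  have key := hS.det_sq_eq_or_le (by rw [hk]; exact ⟨2 * (k + 2), by ring⟩) (by omega)
  have hmb' : (m : ℝ) ^ 4 < (((n : ℝ) - 1) ^ k) ^ 4 := by exact_mod_cast hmb
  have hdet' : (S.det : ℝ) = (((n : ℝ) - 1) ^ (k + 2) - m) ^ 2 := by rw [hdet]; push_cast; rfl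
  have hm' : (0 : ℝ) < m := by exact_mod_cast hm
  replace key : (S.det : ℝ) ^ 2 = ((n : ℝ) - 1) ^ n ∨
      (S.det : ℝ) ^ 2 ≤ ((n : ℝ) - 1) ^ n * (1 - 4 / ((n : ℝ) - 1) ^ 2) :=
    key.imp_left fun h => by exact_mod_cast h
  have hpow : ((n : ℝ) - 1) ^ n = (((n : ℝ) - 1) ^ (k + 2)) ^ 4 := by
    rw [← pow_mul]; congr 1; omega
  rw [hpow, hdet', ← pow_mul] at key
  generalize (n : ℝ) - 1 = N at *
  have hmB : (m : ℝ) < N ^ k := lt_of_pow_lt_pow_left₀ 4 (by positivity) hmb'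
  have hAB : N ^ (k + 2) = N ^ k * N ^ 2 := pow_add _ _ _
  have hBA : N ^ k < N ^ (k + 2) := pow_lt_pow_right₀ hN (by omega)
  have hA : 0 < N ^ (k + 2) := by positivity
  have hgap : N ^ (k + 2) * (4 / N ^ 2) = 4 * N ^ k := by rw [hAB]; field_simp
  generalize N ^ (k + 2) = A at *
  generalize N ^ k = B at *
  rcases key with key | key
  · exact (pow_lt_pow_left₀ (by linarith : A - m < A) (by linarith) (by norm_num)).ne key
  · have h1 : A ^ 4 * (1 - 4 / N ^ 2) = A ^ 4 - A ^ 3 * (4 * B) := by rw [← hgap]; ring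
    have h2 : A ^ 3 * m < A ^ 3 * B := by gcongr
    have h3 : 0 ≤ (m : ℝ) ^ 2 * (2 * A ^ 2 + (2 * A - m) ^ 2) := by positivity
    norm_num at key
    rw [h1] at key
    nlinarith
end

section
/- Let S be a Seidel matrix of order n and let c_S(x) = det(x·I − S) be its characteristic polynomial. For each k with 0 ≤ k ≤ n: if k is odd then the coefficient of x^(n−k) in c_S is 0, and if k is even then the coefficient of x^(n−k) in c_S is at least the binomial coefficient C(n, k). -/
open Matrix Polynomial

/-- A real skew-symmetric matrix has no nonzero real eigenvalue. -/
theorem Matrix.eval_charpoly_ne_zero_of_transpose_eq_neg {ι : Type*} [Fintype ι] [DecidableEq ι]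
    {M : Matrix ι ι ℝ} (hM : Mᵀ = -M) {t : ℝ} (ht : t ≠ 0) : M.charpoly.eval t ≠ 0 := by
  rw [Matrix.eval_charpoly]
  intro h
  obtain ⟨v, hv, hMv⟩ := Matrix.exists_mulVec_eq_zero_iff.mpr h
  have hskew : v ⬝ᵥ (M *ᵥ v) = 0 := by
    have : v ⬝ᵥ (M *ᵥ v) = -(v ⬝ᵥ (M *ᵥ v)) := by
      conv_lhs => rw [dotProduct_mulVec, ← mulVec_transpose, hM, neg_mulVec, neg_dotProduct,
        dotProduct_comm]
    linarith
  have hsq : t * (v ⬝ᵥ v) = 0 := by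
    have := congrArg (v ⬝ᵥ ·) hMv
    simpa [sub_mulVec, dotProduct_sub, hskew, ← smul_one_eq_diagonal, smul_mulVec] using this
  exact hv (dotProduct_self_eq_zero.mp ((mul_eq_zero.mp hsq).resolve_left ht))

/-- The determinant of a real skew-symmetric matrix is nonnegative. -/
theorem Matrix.det_nonneg_of_transpose_eq_neg {ι : Type*} [Fintype ι] [DecidableEq ι]
    {M : Matrix ι ι ℝ} (hM : Mᵀ = -M) : 0 ≤ M.det := by
  cases isEmpty_or_nonempty ι
  · simp
  by_contra! hneg
  have hM' : (-M)ᵀ = -(-M) := by rw [transpose_neg, hM]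
  have h0 : (-M).charpoly.eval 0 = M.det := by simp [Matrix.eval_charpoly]
  have hlim : Filter.Tendsto (fun x => (-M).charpoly.eval x) Filter.atTop Filter.atTop := by
    apply Polynomial.tendsto_atTop_of_leadingCoeff_nonneg
    · rw [Matrix.charpoly_degree_eq_dim]
      exact_mod_cast Fintype.card_pos
    · simp [(-M).charpoly_monic.leadingCoeff]
  obtain ⟨b, hb, hb0⟩ :=
    ((hlim.eventually (Filter.eventually_ge_atTop 0)).and (Filter.eventually_ge_atTop 0)).exists
  obtain ⟨t, -, ht⟩ := intermediate_value_Icc hb0 (-M).charpoly.continuous.continuousOn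
    (show (0 : ℝ) ∈ Set.Icc _ _ from ⟨h0 ▸ hneg.le, hb⟩)
  rcases eq_or_ne t 0 with rfl | ht0
  · exact hneg.ne (h0 ▸ ht)
  · exact Matrix.eval_charpoly_ne_zero_of_transpose_eq_neg hM' ht0 ht

/-- An integer matrix of even order whose diagonal entries are even and whose off-diagonal entries
are odd is nonsingular. -/
theorem Matrix.det_ne_zero_of_even_diag_of_odd_offDiag {ι : Type*} [Fintype ι] [DecidableEq ι]
    {M : Matrix ι ι ℤ} (hι : Even (Fintype.card ι)) (hdiag : ∀ i, Even (M i i))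
    (hoff : ∀ i j, i ≠ j → Odd (M i j)) : M.det ≠ 0 := by
  intro h
  have hmap : M.map (Int.castRingHom (ZMod 2)) = (of fun _ _ => 1) - 1 := by
    ext i j
    rcases eq_or_ne i j with rfl | hij
    · simpa using (ZMod.intCast_eq_zero_iff_even).mpr (hdiag i)
    · simpa [hij] using (ZMod.intCast_eq_one_iff_odd).mpr (hoff i j hij)
  have hJ : (of fun _ _ => 1 : Matrix ι ι (ZMod 2)) * (of fun _ _ => 1) = 0 := by
    ext i j
    simpa [mul_apply] using (ZMod.natCast_eq_zero_iff_even).mpr hι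
  have hsq : ((of fun _ _ => 1) - 1 : Matrix ι ι (ZMod 2)) * ((of fun _ _ => 1) - 1) = 1 := by
    rw [sub_mul, mul_sub, hJ, mul_one, one_mul]
    ext i j
    simp [CharTwo.sub_eq_add, ← add_assoc, CharTwo.add_self_eq_zero]
  have hdet := congrArg det hsq
  rw [← hmap, det_mul, ← RingHom.mapMatrix_apply, ← RingHom.map_det, h] at hdet
  simp at hdet

/-- The determinant of an integer skew-symmetric matrix is nonnegative. -/
theorem Matrix.det_nonneg_of_transpose_eq_neg_int {ι : Type*} [Fintype ι] [DecidableEq ι]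
    {M : Matrix ι ι ℤ} (hM : Mᵀ = -M) : 0 ≤ M.det := by
  have h : 0 ≤ (M.map (Int.castRingHom ℝ)).det := by
    apply Matrix.det_nonneg_of_transpose_eq_neg
    rw [← transpose_map, hM]
    ext i j
    simp
  rw [← RingHom.mapMatrix_apply, ← RingHom.map_det] at h
  simpa using h

/-- An integer skew-symmetric matrix of odd order is singular. -/
theorem Matrix.det_eq_zero_of_transpose_eq_neg_of_odd {ι : Type*} [Fintype ι] [DecidableEq ι]
    {M : Matrix ι ι ℤ} (hM : Mᵀ = -M) (hι : Odd (Fintype.card ι)) : M.det = 0 := by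
  have h := congrArg det hM
  rw [det_transpose, det_neg, hι.neg_one_pow] at h
  lia

/-- in the characteristic polynomial `det (x·I - S)` of a Seidel
matrix of order `n`, for `0 ≤ k ≤ n` the coefficient of `x^(n-k)` is `0` when
`k` is odd, and is at least `C(n,k)` when `k` is even. -/
theorem seidel_charpoly_coeff (n : ℕ) (S : Matrix (Fin n) (Fin n) ℤ)
    (hS : IsSeidel S) (k : ℕ) (hk : k ≤ n) :
    (Odd k → S.charpoly.coeff (n - k) = 0) ∧
    (Even k → ((n.choose k : ℤ)) ≤ S.charpoly.coeff (n - k)) := by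
  obtain ⟨hdiag, hoff, hskew⟩ := hS
  have hcoeff := S.charpoly_coeff_eq_sum_minors k (by simpa using hk)
  rw [Fintype.card_fin] at hcoeff
  have hskew' (s : Finset (Fin n)) :
      (S.submatrix (Subtype.val : s → Fin n) (Subtype.val : s → Fin n))ᵀ =
        -S.submatrix Subtype.val Subtype.val := by
    rw [transpose_submatrix, hskew, submatrix_neg, Pi.neg_apply, Pi.neg_apply]
  have hcard {s : Finset (Fin n)} (hs : s ∈ Finset.univ.powersetCard k) : Fintype.card s = k := by
    simpa using (Finset.mem_powersetCard.mp hs).2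
  rw [hcoeff]
  refine ⟨fun hodd => ?_, fun heven => ?_⟩
  · rw [Finset.sum_eq_zero, mul_zero]
    intro s hs
    exact det_eq_zero_of_transpose_eq_neg_of_odd (hskew' s) ((hcard hs).symm ▸ hodd)
  · rw [heven.neg_one_pow, one_mul]
    have hminor (s) (hs : s ∈ Finset.univ.powersetCard k) :
        1 ≤ (S.submatrix (Subtype.val : s → Fin n) (Subtype.val : s → Fin n)).det := by
      refine Int.add_one_le_of_lt ((det_nonneg_of_transpose_eq_neg_int (hskew' s)).lt_of_ne' ?_)
      apply det_ne_zero_of_even_diag_of_odd_offDiag ((hcard hs).symm ▸ heven)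
      · simp [hdiag]
      · intro i j hij
        rcases hoff i j (Subtype.coe_ne_coe.mpr hij) with h | h <;> simp [h]
    simpa using Finset.card_nsmul_le_sum _ _ 1 hminor
end
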